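/- Let u be a real number with 0 < u < log((3+√5)/2), ξ := u + 2π√-1, and w₀ := (φ(u) + 2π√-1)/ξ. Then ξΦ(w₀) is purely imaginary with strictly positive imaginary part; in particular, Re Φ(w₀) > 0. -/

import Mathlib

open Complex MeasureTheory Filter Topology Finset

noncomputable section

/-- The dilogarithm `Li₂(z) = -∫₀^z log(1-x)/x dx` along the segment from `0` to `z`. -/
def dilog (z : ℂ) : ℂ := -∫ t in (0:ℝ)..1, Complex.log (1 - (t:ℂ) * z) / (t:ℂ)

/-- Colored Jones polynomial of the figure-eight knot (Habiro–Le formula). -/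
def JE (N : ℕ) (q : ℂ) : ℂ :=
  ∑ k ∈ Finset.range N, ∏ l ∈ Finset.Icc 1 k,
    ((q ^ (((N:ℂ) - (l:ℂ))/2) - q ^ (-(((N:ℂ) - (l:ℂ))/2))) *
     (q ^ (((N:ℂ) + (l:ℂ))/2) - q ^ (-(((N:ℂ) + (l:ℂ))/2))))

/-- Integral over the contour `C_R = (-∞,-R] ∪ Ω_R ∪ [R,∞)`, where `Ω_R` is the upper
semicircle of radius `R` traversed from `-R` to `R`. -/
def contourCR (R : ℝ) (f : ℂ → ℂ) : ℂ :=
  (∫ t in Set.Iic (-R), f (t:ℂ)) +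
  (∫ s in (0:ℝ)..Real.pi,
      f ((R:ℂ) * Complex.exp (Complex.I * ((Real.pi:ℂ) - (s:ℂ)))) *
        (-Complex.I * (R:ℂ) * Complex.exp (Complex.I * ((Real.pi:ℂ) - (s:ℂ))))) +
  (∫ t in Set.Ici R, f (t:ℂ))

/-- Faddeev's quantum dilogarithm `S_γ(z)`. -/
def Sqd (γ : ℂ) (R : ℝ) (z : ℂ) : ℂ :=
  Complex.exp ((1/4) * contourCR R
    (fun t => Complex.exp (z * t) / (Complex.sinh ((Real.pi:ℂ) * t) * Complex.sinh (γ * t) * t)))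

/-- The square root of `(e^u+e^{-u}+1)(e^u+e^{-u}-3)` chosen as a positive multiple of `√-1`. -/
def betaRoot (u : ℝ) : ℂ :=
  Complex.I * (Real.sqrt (-((Real.exp u + Real.exp (-u) + 1) * (Real.exp u + Real.exp (-u) - 3))) : ℝ)

/-- `φ(u) = arccosh(cosh u - 1/2)` with the branch described in the paper. -/
def phiu (u : ℝ) : ℂ :=
  Complex.log (((Real.exp u + Real.exp (-u) - 1 : ℝ) - betaRoot u) / 2)

/-- `S(u) = Li₂(e^{u-φ(u)}) - Li₂(e^{u+φ(u)}) - uφ(u)`. -/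
def Su (u : ℝ) : ℂ :=
  dilog (Complex.exp ((u:ℂ) - phiu u)) - dilog (Complex.exp ((u:ℂ) + phiu u)) - (u:ℂ) * phiu u

/-- `Φ(w) = (1/ξ)(Li₂(e^{u-ξw}) - Li₂(e^{u+ξw})) - uw` with `ξ = u + 2π√-1`. -/
def Phi (u : ℝ) (w : ℂ) : ℂ :=
  (1/((u:ℂ) + 2*(Real.pi:ℂ)*Complex.I)) *
    (dilog (Complex.exp ((u:ℂ) - ((u:ℂ) + 2*(Real.pi:ℂ)*Complex.I) * w)) -
     dilog (Complex.exp ((u:ℂ) + ((u:ℂ) + 2*(Real.pi:ℂ)*Complex.I) * w))) - (u:ℂ) * w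

/-- `g_N(w) = e^{-Nuw} S_γ(π-√-1u+√-1ξw)/S_γ(-π-√-1u-√-1ξw)`, `γ = (2π-√-1u)/(2N)`. -/
def gN (u : ℝ) (N : ℕ) (R : ℝ) (w : ℂ) : ℂ :=
  Complex.exp (-(N:ℂ) * (u:ℂ) * w) *
    Sqd ((2*(Real.pi:ℂ) - Complex.I*(u:ℂ))/(2*(N:ℂ))) R
      ((Real.pi:ℂ) - Complex.I*(u:ℂ) + Complex.I*((u:ℂ) + 2*(Real.pi:ℂ)*Complex.I)*w) /
    Sqd ((2*(Real.pi:ℂ) - Complex.I*(u:ℂ))/(2*(N:ℂ))) R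
      (-(Real.pi:ℂ) - Complex.I*(u:ℂ) - Complex.I*((u:ℂ) + 2*(Real.pi:ℂ)*Complex.I)*w)

/-- Integral of `f` along the straight segment from `a` to `b`. -/
def segInt (f : ℂ → ℂ) (a b : ℂ) : ℂ :=
  ∫ t in (0:ℝ)..1, f (a + (t:ℂ) * (b - a)) * (b - a)

/-- Integral of `f` along the polygonal line through the given list of vertices. -/
def polyInt (f : ℂ → ℂ) : List ℂ → ℂ
  | a :: b :: rest => segInt f a b + polyInt f (b :: rest)
  | _ => 0

/-- Vertices of the polygonal line `C_+(ε)`. -/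
def Cplus (u ε : ℝ) : List ℂ :=
  [((1 - ε : ℝ) : ℂ),
   ((1 - u/(2*Real.pi) - ε : ℝ) : ℂ) + Complex.I,
   ((-(u/(2*Real.pi)) + ε : ℝ) : ℂ) + Complex.I,
   ((ε : ℝ) : ℂ)]

/-- Vertices of the polygonal line `C_-(ε)`. -/
def Cminus (u ε : ℝ) : List ℂ :=
  [((ε : ℝ) : ℂ),
   ((u/(2*Real.pi) : ℝ) : ℂ) - Complex.I,
   ((1 + u/(2*Real.pi) : ℝ) : ℂ) - Complex.I,
   ((1 - ε : ℝ) : ℂ)]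

/-- `I_γ(z)` from Andersen–Hansen. -/
def Iqd (γ : ℂ) (R : ℝ) (z : ℂ) : ℂ :=
  (1/4) * contourCR R
    (fun t => Complex.exp (z * t) / (t * Complex.sinh ((Real.pi:ℂ) * t)) *
      (1/Complex.sinh (γ * t) - 1/(γ * t)))

end

/-- The function `log(1-z)/z`, with its removable singularity at `0` filled in. -/
noncomputable abbrev logSlope : ℂ → ℂ := dslope (fun z : ℂ => Complex.log (1 - z)) 0

theorem logSlope_of_ne {z : ℂ} (hz : z ≠ 0) : logSlope z = Complex.log (1 - z) / z := by
  rw [logSlope, dslope_of_ne _ hz, slope_def_field]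
  simp

theorem dilog_eq_integral_logSlope (z : ℂ) :
    dilog z = -∫ t in (0:ℝ)..1, z * logSlope ((t:ℂ) * z) := by
  unfold dilog
  congr 1
  refine intervalIntegral.integral_congr_ae (Eventually.of_forall fun t ht => ?_)
  rw [Set.uIoc_of_le zero_le_one] at ht
  have ht0 : (t:ℂ) ≠ 0 := by exact_mod_cast ht.1.ne'
  rcases eq_or_ne z 0 with rfl | hz
  · simp
  · simp only [logSlope_of_ne (mul_ne_zero ht0 hz)]
    field_simp

theorem differentiableAt_log_one_sub {z : ℂ} (hz : 1 - z ∈ slitPlane) :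
    DifferentiableAt ℂ (fun z : ℂ => Complex.log (1 - z)) z :=
  ((differentiableAt_const _).sub differentiableAt_id).clog hz

theorem continuousAt_logSlope {z : ℂ} (hz : 1 - z ∈ slitPlane) : ContinuousAt logSlope z := by
  rcases eq_or_ne z 0 with rfl | h0
  · exact continuousAt_dslope_same.2 (differentiableAt_log_one_sub hz)
  · exact (continuousAt_dslope_of_ne h0).2 (differentiableAt_log_one_sub hz).continuousAt

theorem one_sub_mem_slitPlane_of_norm_lt {z : ℂ} (hz : ‖z‖ < 1) : 1 - z ∈ slitPlane :=
  ball_one_subset_slitPlane (by simpa [dist_eq_norm] using hz)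

theorem one_sub_mem_slitPlane_of_im_ne {z : ℂ} (hz : z.im ≠ 0) : 1 - z ∈ slitPlane :=
  Or.inr (by simpa using hz)

/-- On the unit disc the dilogarithm is a primitive of `-log(1-z)/z`. -/
theorem hasDerivAt_dilog {z : ℂ} (hz : ‖z‖ < 1) : HasDerivAt dilog (-logSlope z) z := by
  have hdiff : DifferentiableOn ℂ logSlope (Metric.ball 0 1) := by
    rw [logSlope, Complex.differentiableOn_dslope (Metric.ball_mem_nhds _ one_pos)]
    intro w hw
    exact (differentiableAt_log_one_sub (one_sub_mem_slitPlane_of_norm_lt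
      (by simpa using hw))).differentiableWithinAt
  obtain ⟨P, hP⟩ := hdiff.isExactOn_ball
  have key : ∀ w ∈ Metric.ball (0:ℂ) 1, dilog w = -(P w - P 0) := by
    intro w hw
    rw [dilog_eq_integral_logSlope]
    have hmem : ∀ t ∈ Set.uIcc (0:ℝ) 1, (t:ℂ) * w ∈ Metric.ball (0:ℂ) 1 := by
      intro t ht
      rw [Set.uIcc_of_le zero_le_one] at ht
      have hw' : ‖w‖ < 1 := by simpa using hw
      have : |t| * ‖w‖ < 1 := by
        rw [abs_of_nonneg ht.1]
        nlinarith [norm_nonneg w, ht.2]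
      simpa using this
    have hd : ∀ t ∈ Set.uIcc (0:ℝ) 1,
        HasDerivAt (fun t : ℝ => P ((t:ℂ) * w)) (w * logSlope ((t:ℂ) * w)) t := by
      intro t ht
      have h1 : HasDerivAt (fun t : ℝ => (t:ℂ) * w) w t := by
        simpa using (Complex.ofRealCLM.hasDerivAt (x := t)).mul_const w
      have h2 := HasDerivAt.comp t (hP _ (hmem t ht)) h1
      rw [mul_comm]
      exact h2
    have hint : IntervalIntegrable (fun t : ℝ => w * logSlope ((t:ℂ) * w)) volume 0 1 := by
      apply ContinuousOn.intervalIntegrable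
      refine continuousOn_const.mul (hdiff.continuousOn.comp (by fun_prop) hmem)
    rw [intervalIntegral.integral_eq_sub_of_hasDerivAt hd hint]
    simp
  have hz' : z ∈ Metric.ball (0:ℂ) 1 := by simpa using hz
  have h := ((hP z hz').sub_const (P 0)).neg
  refine h.congr_of_eventuallyEq ?_
  filter_upwards [Metric.isOpen_ball.mem_nhds hz'] with w hw using key w hw

/-- The radial logarithmic derivative of the dilogarithm. -/
theorem hasDerivAt_dilog_exp_mul {E : ℂ} (hE : E.im ≠ 0) (x : ℝ) :
    HasDerivAt (fun x : ℝ => dilog ((Real.exp x : ℝ) * E))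
      (-Complex.log (1 - (Real.exp x : ℝ) * E)) x := by
  have hE0 : E ≠ 0 := by rintro rfl; simp at hE
  have hcont : Continuous (fun s : ℝ => E * logSlope ((s:ℂ) * E)) := by
    refine continuous_const.mul (continuous_iff_continuousAt.2 fun s => ?_)
    have hs : 1 - (s:ℂ) * E ∈ slitPlane := by
      rcases eq_or_ne s 0 with rfl | hs
      · simp
      · exact one_sub_mem_slitPlane_of_im_ne (by simpa using ⟨hs, hE⟩)
    exact ContinuousAt.comp (f := fun s : ℝ => (s:ℂ) * E) (continuousAt_logSlope hs)
      (by fun_prop)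
  have heq : (fun x : ℝ => dilog ((Real.exp x : ℝ) * E)) =
      fun x : ℝ => -∫ s in (0:ℝ)..Real.exp x, E * logSlope ((s:ℂ) * E) := by
    funext x
    rw [dilog_eq_integral_logSlope]
    congr 1
    have h := intervalIntegral.smul_integral_comp_mul_left (a := 0) (b := 1)
      (fun s : ℝ => E * logSlope ((s:ℂ) * E)) (Real.exp x)
    rw [mul_zero, mul_one] at h
    rw [← h, ← intervalIntegral.integral_smul]
    refine intervalIntegral.integral_congr fun t _ => ?_
    simp only [Complex.real_smul, Complex.ofReal_mul]
    rw [show (t:ℂ) * ((Real.exp x : ℝ) * E) = (Real.exp x : ℝ) * t * E by ring]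
    ring
  rw [heq]
  have h1 := intervalIntegral.integral_hasDerivAt_right (hcont.intervalIntegrable 0 (Real.exp x))
    (hcont.stronglyMeasurableAtFilter _ _) hcont.continuousAt
  have h2 := (HasDerivAt.scomp x h1 (Real.hasDerivAt_exp x)).neg
  convert! h2 using 1
  have he : ((Real.exp x : ℝ) : ℂ) ≠ 0 := by exact_mod_cast (Real.exp_pos x).ne'
  rw [logSlope_of_ne (mul_ne_zero he hE0), Complex.real_smul]
  field_simp

theorem dilog_conj {z : ℂ} (hz : ∀ t ∈ Set.Icc (0:ℝ) 1, 1 - (t:ℂ) * z ∈ slitPlane) :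
    dilog (starRingEnd ℂ z) = starRingEnd ℂ (dilog z) := by
  unfold dilog
  rw [map_neg, ← intervalIntegral.intervalIntegral_conj]
  congr 1
  refine intervalIntegral.integral_congr fun t ht => ?_
  rw [Set.uIcc_of_le zero_le_one] at ht
  have h := Complex.log_conj (1 - (t:ℂ) * z) (slitPlane_arg_ne_pi (hz t ht))
  simp only [map_div₀, Complex.conj_ofReal, ← h, map_sub, map_mul, map_one]

theorem dilog_conj_of_im_ne {z : ℂ} (hz : z.im ≠ 0) :
    dilog (starRingEnd ℂ z) = starRingEnd ℂ (dilog z) := by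
  refine dilog_conj fun t _ => ?_
  rcases eq_or_ne t 0 with rfl | ht
  · simp
  · exact one_sub_mem_slitPlane_of_im_ne (by simpa using ⟨ht, hz⟩)

theorem dilog_ofReal_im {x : ℝ} (hx : x < 1) : (dilog x).im = 0 := by
  rw [← Complex.conj_eq_iff_im, ← dilog_conj, Complex.conj_ofReal]
  intro t ht
  refine Or.inl ?_
  have : t * x < 1 := by
    rcases le_or_gt x 0 with h | h
    · nlinarith [ht.1]
    · nlinarith [ht.2]
  simpa using this

theorem one_sub_mul_one_sub (x θ : ℝ) :
    (1 - (Real.exp x : ℝ) * Complex.exp (θ * I)) * (1 - (Real.exp (-x) : ℝ) * Complex.exp (θ * I)) =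
      (2 * Real.cosh x - 2 * Real.cos θ : ℝ) * Complex.exp ((θ - Real.pi : ℝ) * I) := by
  have h1 : ((Real.exp x : ℝ) : ℂ) * (Real.exp (-x) : ℝ) = 1 := by
    rw [← Complex.ofReal_mul, ← Real.exp_add]; simp
  have h2 : Complex.exp (θ * I) * Complex.exp (-(θ * I)) = 1 := by
    rw [← Complex.exp_add]; simp
  have h3 : Complex.exp ((θ - Real.pi : ℝ) * I) = -Complex.exp (θ * I) := by
    push_cast
    rw [sub_mul, Complex.exp_sub, Complex.exp_pi_mul_I]; ring
  have h4 : (2 * Real.cos θ : ℂ) = Complex.exp (θ * I) + Complex.exp (-(θ * I)) := by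
    rw [Complex.ofReal_cos, Complex.cos]; ring_nf
  have h5 : (2 * Real.cosh x : ℂ) = (Real.exp x : ℝ) + (Real.exp (-x) : ℝ) := by
    rw [Real.cosh_eq]; push_cast; ring
  rw [h3]
  push_cast [-Complex.ofReal_exp, -Complex.ofReal_cosh, -Complex.ofReal_cos]
  rw [h4, h5]
  linear_combination Complex.exp (θ * I) ^ 2 * h1 - h2

theorem arg_one_sub_mem {x θ : ℝ} (h0 : 0 < θ) (hpi : θ < Real.pi) :
    (1 - (Real.exp x : ℝ) * Complex.exp (θ * I)).arg ∈ Set.Ioo (-Real.pi) 0 := by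
  refine ⟨Complex.neg_pi_lt_arg _, Complex.arg_neg_iff.2 ?_⟩
  have : (1 - (Real.exp x : ℝ) * Complex.exp (θ * I)).im = -(Real.exp x * Real.sin θ) := by
    rw [Complex.sub_im, Complex.im_ofReal_mul, Complex.exp_ofReal_mul_I_im, Complex.one_im, zero_sub]
  rw [this]
  have := mul_pos (Real.exp_pos x) (Real.sin_pos_of_pos_of_lt_pi h0 hpi)
  linarith

theorem arg_one_sub_add_arg_one_sub {θ : ℝ} (h0 : 0 < θ) (hpi : θ < Real.pi) (x : ℝ) :
    (1 - (Real.exp x : ℝ) * Complex.exp (θ * I)).arg +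
      (1 - (Real.exp (-x) : ℝ) * Complex.exp (θ * I)).arg = θ - Real.pi := by
  have ha := arg_one_sub_mem (x := x) h0 hpi
  have hb := arg_one_sub_mem (x := -x) h0 hpi
  have hne : ∀ z : ℂ, z.arg ∈ Set.Ioo (-Real.pi) 0 → z ≠ 0 := by
    rintro z hz rfl
    simp at hz
  have h := Complex.arg_mul_coe_angle (hne _ ha) (hne _ hb)
  have hpos : 0 < 2 * Real.cosh x - 2 * Real.cos θ := by
    have h1 := Real.one_le_cosh x
    have h2 : Real.cos θ < 1 := by
      rw [← Real.cos_zero]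
      exact Real.cos_lt_cos_of_nonneg_of_le_pi le_rfl hpi.le h0
    linarith
  rw [one_sub_mul_one_sub, Complex.arg_real_mul _ hpos, Complex.arg_exp_mul_I,
    (toIocMod_eq_self _).2 ⟨by linarith, by linarith⟩, ← Real.Angle.coe_add,
    Real.Angle.angle_eq_iff_two_pi_dvd_sub] at h
  obtain ⟨k, hk⟩ := h
  have hk0 : k = 0 := by
    have h1 : (k:ℝ) < 1 := by
      by_contra! hc
      nlinarith [Real.pi_pos, ha.1, hb.1, ha.2, hb.2]
    have h2 : (-1:ℝ) < k := by
      by_contra! hc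
      nlinarith [Real.pi_pos, ha.1, hb.1, ha.2, hb.2]
    have h1' : k < 1 := by exact_mod_cast h1
    have h2' : -1 < k := by exact_mod_cast h2
    omega
  rw [hk0, Int.cast_zero, mul_zero] at hk
  linarith

/-- The inversion formula for the imaginary part of the dilogarithm. -/
theorem dilog_inversion_im {θ : ℝ} (h0 : 0 < θ) (hpi : θ < Real.pi) (u : ℝ) :
    (dilog ((Real.exp u : ℝ) * Complex.exp (θ * I))).im =
      (dilog ((Real.exp (-u) : ℝ) * Complex.exp (θ * I))).im + (Real.pi - θ) * u := by
  have hE : (Complex.exp (θ * I)).im ≠ 0 := by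
    rw [Complex.exp_ofReal_mul_I_im]
    exact (Real.sin_pos_of_pos_of_lt_pi h0 hpi).ne'
  set F : ℝ → ℝ := fun x => (dilog ((Real.exp x : ℝ) * Complex.exp (θ * I))).im with hF
  have hFd : ∀ x, HasDerivAt F (-(1 - (Real.exp x : ℝ) * Complex.exp (θ * I)).arg) x := by
    intro x
    have h := Complex.imCLM.hasFDerivAt.comp_hasDerivAt x (hasDerivAt_dilog_exp_mul hE x)
    convert! h using 1
    simp only [Complex.imCLM_apply, Complex.neg_im, Complex.log_im]
  have hG : ∀ x, HasDerivAt (fun x => F x - F (-x) - (Real.pi - θ) * x) 0 x := by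
    intro x
    have h1 := (hFd (-x)).comp x (hasDerivAt_neg x)
    have h2 := ((hFd x).sub h1).sub ((hasDerivAt_id x).const_mul (Real.pi - θ))
    convert! h2 using 1
    linarith [arg_one_sub_add_arg_one_sub h0 hpi x]
  have := is_const_of_deriv_eq_zero (fun x => (hG x).differentiableAt) (fun x => (hG x).deriv) u 0
  simp at this
  linarith

theorem hasDerivAt_dilog_im_angle {u : ℝ} (hu : 0 < u) (θ : ℝ) :
    HasDerivAt (fun θ : ℝ => 2 * (dilog ((Real.exp (-u) : ℝ) * Complex.exp (θ * I))).im - u * θ)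
      (-Real.log (2 * Real.cosh u - 2 * Real.cos θ)) θ := by
  set z : ℂ := (Real.exp (-u) : ℝ) * Complex.exp (θ * I) with hz
  have hnorm : ‖z‖ < 1 := by
    rw [hz, norm_mul, Complex.norm_exp_ofReal_mul_I, Complex.norm_real, Real.norm_eq_abs,
      Real.abs_exp, mul_one, Real.exp_lt_one_iff]
    linarith
  have hz0 : z ≠ 0 := mul_ne_zero (by exact_mod_cast (Real.exp_pos _).ne') (Complex.exp_ne_zero _)
  have h1 : HasDerivAt (fun θ : ℝ => ((Real.exp (-u) : ℝ) : ℂ) * Complex.exp (θ * I)) (z * I) θ := by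
    have h := (((Complex.ofRealCLM.hasDerivAt (x := θ)).mul_const I).cexp).const_mul
      ((Real.exp (-u) : ℝ) : ℂ)
    simpa [hz, mul_assoc] using! h
  have h2 := Complex.imCLM.hasFDerivAt.comp_hasDerivAt θ (HasDerivAt.comp θ (hasDerivAt_dilog hnorm) h1)
  have h3 := (h2.const_mul 2).sub ((hasDerivAt_id θ).const_mul u)
  convert! h3 using 1
  have hnsq : Real.exp u * Complex.normSq (1 - z) = 2 * Real.cosh u - 2 * Real.cos θ := by
    have hre : z.re = Real.exp (-u) * Real.cos θ := by
      rw [hz, Complex.re_ofReal_mul, Complex.exp_ofReal_mul_I_re]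
    have him : z.im = Real.exp (-u) * Real.sin θ := by
      rw [hz, Complex.im_ofReal_mul, Complex.exp_ofReal_mul_I_im]
    have he : Real.exp u * Real.exp (-u) = 1 := by rw [← Real.exp_add]; simp
    rw [Complex.normSq_apply, Complex.sub_re, Complex.sub_im, hre, him, Real.cosh_eq]
    simp only [Complex.one_re, Complex.one_im]
    linear_combination (Real.exp (-u) - 2 * Real.cos θ) * he +
      Real.exp u * Real.exp (-u) ^ 2 * Real.sin_sq_add_cos_sq θ
  have hne : 1 - z ≠ 0 := slitPlane_ne_zero (one_sub_mem_slitPlane_of_norm_lt hnorm)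
  rw [← hnsq, Real.log_mul (Real.exp_pos u).ne' (by simpa using hne), Real.log_exp,
    Complex.normSq_eq_norm_sq, Real.log_pow, ← Complex.log_re, logSlope_of_ne hz0]
  have : -(Complex.log (1 - z) / z) * (z * I) = -(Complex.log (1 - z) * I) := by field_simp
  rw [this]
  simp
  ring

theorem two_mul_cosh_lt_three {u : ℝ} (hu0 : 0 < u)
    (hu1 : u < Real.log ((3 + Real.sqrt 5) / 2)) : 2 * Real.cosh u < 3 := by
  have h5 : Real.sqrt 5 ^ 2 = 5 := Real.sq_sqrt (by norm_num)
  have h5p : 0 ≤ Real.sqrt 5 := Real.sqrt_nonneg 5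
  have hlt : Real.exp u < (3 + Real.sqrt 5) / 2 :=
    (Real.lt_log_iff_exp_lt (by positivity)).1 hu1
  have h1 : 1 < Real.exp u := Real.one_lt_exp_iff.2 hu0
  have he : Real.exp u * Real.exp (-u) = 1 := by rw [← Real.exp_add]; simp
  rw [Real.cosh_eq]
  have h25 : 2 < Real.sqrt 5 := by nlinarith
  have hq : Real.exp u ^ 2 - 3 * Real.exp u + 1 < 0 := by nlinarith
  by_contra! hc
  have : 0 ≤ Real.exp u * (Real.exp u + Real.exp (-u) - 3) :=
    mul_nonneg (by linarith) (by linarith)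
  nlinarith

theorem phiu_eq {u : ℝ} (h1 : 2 * Real.cosh u < 3) :
    phiu u = -(Real.arccos (Real.cosh u - 1 / 2) * I) := by
  have hc1 := Real.one_le_cosh u
  set θ := Real.arccos (Real.cosh u - 1 / 2) with hθ
  have hcos : Real.cos θ = Real.cosh u - 1 / 2 := Real.cos_arccos (by linarith) (by linarith)
  have hsum : Real.exp u + Real.exp (-u) = 2 * Real.cosh u := by rw [Real.cosh_eq]; ring
  have hsin : Real.sqrt (-((Real.exp u + Real.exp (-u) + 1) * (Real.exp u + Real.exp (-u) - 3))) =
      2 * Real.sin θ := by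
    have hs0 : 0 ≤ Real.sin θ :=
      Real.sin_nonneg_of_nonneg_of_le_pi (Real.arccos_nonneg _) (Real.arccos_le_pi _)
    rw [hsum, ← Real.sqrt_sq (mul_nonneg zero_le_two hs0), mul_pow, Real.sin_sq, hcos]
    congr 1
    ring
  have : ((Real.exp u + Real.exp (-u) - 1 : ℝ) - betaRoot u) / 2 =
      Complex.exp ((-θ : ℝ) * I) := by
    rw [betaRoot, hsin, hsum, Complex.exp_mul_I, ← Complex.ofReal_cos, ← Complex.ofReal_sin,
      Real.cos_neg, Real.sin_neg, hcos]
    push_cast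
    ring
  have hpi : θ < Real.pi := by
    rw [hθ, ← Real.arccos_neg_one]
    exact Real.arccos_lt_arccos le_rfl (by linarith) (by linarith)
  rw [phiu, this, Complex.log_exp]
  · push_cast; ring
  · simpa using hpi
  · have := Real.arccos_nonneg (Real.cosh u - 1 / 2)
    have := Real.pi_pos
    simp
    linarith

/-- `ξΦ(w₀)` is purely imaginary with positive imaginary part, and
consequently `Re Φ(w₀) > 0`. -/
theorem stmt8 (u : ℝ) (hu0 : 0 < u) (hu1 : u < Real.log ((3 + Real.sqrt 5)/2))
    (ξ w₀ : ℂ) (hξ : ξ = (u:ℂ) + 2*(Real.pi:ℂ)*Complex.I)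
    (hw : w₀ = (phiu u + 2*(Real.pi:ℂ)*Complex.I)/ξ) :
    (ξ * Phi u w₀).re = 0 ∧ 0 < (ξ * Phi u w₀).im ∧ 0 < (Phi u w₀).re := by
  have hcosh := two_mul_cosh_lt_three hu0 hu1
  have hc1 : 1 < Real.cosh u := Real.one_lt_cosh.2 hu0.ne'
  have hphi := phiu_eq hcosh
  set θ := Real.arccos (Real.cosh u - 1 / 2) with hθ
  have hcos : Real.cos θ = Real.cosh u - 1 / 2 := Real.cos_arccos (by linarith) (by linarith)
  have hθ0 : 0 < θ := Real.arccos_pos.2 (by linarith)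
  have hθpi : θ < Real.pi := by
    rw [hθ, ← Real.arccos_neg_one]
    exact Real.arccos_lt_arccos le_rfl (by linarith) (by linarith)
  have hsin := Real.sin_pos_of_pos_of_lt_pi hθ0 hθpi
  set z : ℂ := (Real.exp u : ℝ) * Complex.exp (θ * I) with hz
  have hzim : z.im ≠ 0 := by
    rw [hz, Complex.im_ofReal_mul, Complex.exp_ofReal_mul_I_im]
    exact (mul_pos (Real.exp_pos u) hsin).ne'
  set Y : ℝ := 2 * (dilog z).im + u * θ - 2 * Real.pi * u with hY
  have hYpos : 0 < Y := by
    set G : ℝ → ℝ := fun θ => 2 * (dilog ((Real.exp (-u) : ℝ) * Complex.exp (θ * I))).im - u * θ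
      with hG
    have hmono : StrictMonoOn G (Set.Icc 0 θ) := by
      refine strictMonoOn_of_deriv_pos (convex_Icc _ _)
        (fun x _ => (hasDerivAt_dilog_im_angle hu0 x).continuousAt.continuousWithinAt) ?_
      intro x hx
      rw [interior_Icc] at hx
      rw [(hasDerivAt_dilog_im_angle hu0 x).deriv]
      have h1 : Real.cos θ < Real.cos x :=
        Real.cos_lt_cos_of_nonneg_of_le_pi hx.1.le hθpi.le hx.2
      have h2 := Real.cos_le_one x
      have := Real.log_neg (x := 2 * Real.cosh u - 2 * Real.cos x) (by linarith) (by linarith)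
      linarith
    have hG0 : G 0 = 0 := by
      have h := dilog_ofReal_im (x := Real.exp (-u)) (by rw [Real.exp_lt_one_iff]; linarith)
      simp only [hG, Complex.ofReal_zero, zero_mul, Complex.exp_zero, mul_one, h]
      ring
    have hlt := hmono ⟨le_rfl, hθ0.le⟩ ⟨hθ0.le, le_rfl⟩ hθ0
    rw [hG0] at hlt
    have hinv := dilog_inversion_im hθ0 hθpi u
    simp only [hG] at hlt
    rw [hY, hz, hinv]
    linarith
  have hξ0 : ξ ≠ 0 := by
    intro h
    have := congrArg Complex.re (hξ.symm.trans h)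
    simp at this
    exact hu0.ne' this
  have hξw : ξ * w₀ = -(θ * I) + 2 * Real.pi * I := by
    rw [hw, hphi]; field_simp
  have hexp1 : Complex.exp (u - ξ * w₀) = z := by
    rw [hξw, hz, Complex.ofReal_exp, ← Complex.exp_add,
      show (u:ℂ) - (-(θ * I) + 2 * Real.pi * I) = u + θ * I - 2 * Real.pi * I by ring,
      Complex.exp_periodic.sub_eq]
  have hexp2 : Complex.exp (u + ξ * w₀) = starRingEnd ℂ z := by
    rw [hξw, hz, Complex.ofReal_exp, ← Complex.exp_add, ← Complex.exp_conj,
      show (u:ℂ) + (-(θ * I) + 2 * Real.pi * I) = u - θ * I + 2 * Real.pi * I by ring,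
      Complex.exp_periodic]
    simp [sub_eq_add_neg]
  have hmain : ξ * Phi u w₀ = Y * I := by
    have : ξ * Phi u w₀ = dilog z - starRingEnd ℂ (dilog z) - u * (ξ * w₀) := by
      rw [Phi, ← hξ, hexp1, hexp2, dilog_conj_of_im_ne hzim]
      field_simp
    rw [this, Complex.sub_conj, hξw, hY]
    push_cast
    ring
  refine ⟨by simp [hmain], by simpa [hmain] using hYpos, ?_⟩
  have hPhi : Phi u w₀ = Y * I / ξ := by rw [← hmain]; field_simp
  have hre : (Phi u w₀).re = Y * (2 * Real.pi) / Complex.normSq ξ := by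
    rw [hPhi, Complex.div_re]
    simp [hξ]
  rw [hre]
  exact div_pos (mul_pos hYpos (by positivity)) (Complex.normSq_pos.2 hξ0)
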